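/- arXiv:1611.04170 — 5 statements merged into one kernel-verified Lean document; each statement's English description precedes it below -/
import Mathlib

section
/- Let A, A' be types of atomic sentences, W, W' types of base models, sat : W → A → Prop and sat' : W' → A' → Prop base satisfaction relations, and let f : A → A' and g : W' → W satisfy the satisfaction condition: for all w' : W' and ψ : A, sat (g w') ψ ↔ sat' w' (f ψ). Then temporalisation preserves the satisfaction condition: for every temporal model m' : ℕ → W', every instant j : ℕ, and every temporal formula ρ over A, (g ∘ m') satisfies ρ at instant j (with respect to sat) if and only if m' satisfies map f ρ at instant j (with respect to sat'). In particular, (g ∘ m') globally satisfies ρ iff m' globally satisfies map f ρ. -/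
/-- Temporal formulas over a type `A` of atomic sentences. -/
inductive TForm (A : Type*) : Type _ where
  | atom : A → TForm A
  | neg : TForm A → TForm A
  | conj : TForm A → TForm A → TForm A
  | next : TForm A → TForm A
  | untl : TForm A → TForm A → TForm A

/-- Translation of temporal formulas along a map on atoms. -/
def TForm.map {A A' : Type*} (f : A → A') : TForm A → TForm A'
  | .atom ψ => .atom (f ψ)
  | .neg ρ => .neg (ρ.map f)
  | .conj ρ ρ' => .conj (ρ.map f) (ρ'.map f)
  | .next ρ => .next (ρ.map f)
  | .untl ρ ρ' => .untl (ρ.map f) (ρ'.map f)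

/-- Satisfaction of a temporal formula by a temporal model `m : ℕ → W` at instant `j`. -/
def TSat {A W : Type*} (sat : W → A → Prop) (m : ℕ → W) : ℕ → TForm A → Prop
  | j, .atom ψ => sat (m j) ψ
  | j, .neg ρ => ¬ TSat sat m j ρ
  | j, .conj ρ ρ' => TSat sat m j ρ ∧ TSat sat m j ρ'
  | j, .next ρ => TSat sat m (j + 1) ρ
  | j, .untl ρ ρ' => ∃ k, j ≤ k ∧ TSat sat m k ρ' ∧ ∀ i, j ≤ i → i < k → TSat sat m i ρ

theorem temporalisation_preserves_satisfaction_condition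
    {A A' W W' : Type*} (sat : W → A → Prop) (sat' : W' → A' → Prop)
    (f : A → A') (g : W' → W)
    (h : ∀ (w' : W') (ψ : A), sat (g w') ψ ↔ sat' w' (f ψ)) :
    (∀ (m' : ℕ → W') (j : ℕ) (ρ : TForm A),
      TSat sat (g ∘ m') j ρ ↔ TSat sat' m' j (ρ.map f)) ∧
    (∀ (m' : ℕ → W') (ρ : TForm A),
      TSat sat (g ∘ m') 0 ρ ↔ TSat sat' m' 0 (ρ.map f)) := by
  have key : ∀ (m' : ℕ → W') (ρ : TForm A) (j : ℕ),
      TSat sat (g ∘ m') j ρ ↔ TSat sat' m' j (ρ.map f) := by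
    intro m' ρ
    induction ρ with
    | atom ψ => intro j; simpa only [TSat, TForm.map, Function.comp_apply] using h (m' j) ψ
    | neg ρ ih => intro j; simp only [TSat, TForm.map, ih]
    | conj ρ ρ' ih ih' => intro j; simp only [TSat, TForm.map, ih, ih']
    | next ρ ih => intro j; simp only [TSat, TForm.map, ih]
    | untl ρ ρ' ih ih' => intro j; simp only [TSat, TForm.map, ih, ih']
  exact ⟨fun m' j ρ => key m' ρ j, fun m' ρ => key m' ρ 0⟩
end

section
/- Let A, A' be types of atomic sentences, W, W' types of base models, sat : W → A → Prop and sat' : W' → A' → Prop base satisfaction relations, and let f : A → A' and g : W' → W satisfy the satisfaction condition: for all w' : W' and ψ : A, sat (g w') ψ ↔ sat' w' (f ψ). Then probabilisation preserves the satisfaction condition: for every probabilistic model (S, p, m') over W' and every probabilistic sentence ρ over A, the reduct model (S, p, g ∘ m') satisfies ρ (with respect to sat) if and only if (S, p, m') satisfies map f ρ (with respect to sat'). -/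
/-- Probabilistic terms over a type `A` of atomic sentences. -/
inductive PTerm (A : Type*) : Type _ where
  | const : ℝ → PTerm A
  | integral : A → PTerm A
  | add : PTerm A → PTerm A → PTerm A
  | mul : PTerm A → PTerm A → PTerm A

/-- Probabilistic sentences over a type `A` of atomic sentences. -/
inductive PSen (A : Type*) : Type _ where
  | lt : PTerm A → PTerm A → PSen A
  | neg : PSen A → PSen A
  | conj : PSen A → PSen A → PSen A

/-- Translation of probabilistic terms along a map on atoms. -/
def PTerm.map {A A' : Type*} (f : A → A') : PTerm A → PTerm A'
  | .const r => .const r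
  | .integral ψ => .integral (f ψ)
  | .add t t' => .add (t.map f) (t'.map f)
  | .mul t t' => .mul (t.map f) (t'.map f)

/-- Translation of probabilistic sentences along a map on atoms. -/
def PSen.map {A A' : Type*} (f : A → A') : PSen A → PSen A'
  | .lt t t' => .lt (t.map f) (t'.map f)
  | .neg ρ => .neg (ρ.map f)
  | .conj ρ ρ' => .conj (ρ.map f) (ρ'.map f)

/-- Interpretation of a probabilistic term in a probabilistic model `(S, p, m)`. -/
def PTerm.interp {A W S : Type*} (sat : W → A → Prop) (p : Set S → ℝ) (m : S → W) :
    PTerm A → ℝ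
  | .const r => r
  | .integral ψ => p {s : S | sat (m s) ψ}
  | .add t t' => t.interp sat p m + t'.interp sat p m
  | .mul t t' => t.interp sat p m * t'.interp sat p m

/-- Satisfaction of a probabilistic sentence in a probabilistic model `(S, p, m)`. -/
def PSen.sat {A W S : Type*} (sat : W → A → Prop) (p : Set S → ℝ) (m : S → W) :
    PSen A → Prop
  | .lt t t' => t.interp sat p m < t'.interp sat p m
  | .neg ρ => ¬ ρ.sat sat p m
  | .conj ρ ρ' => ρ.sat sat p m ∧ ρ'.sat sat p m

theorem probabilisation_preserves_satisfaction_condition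
    {A A' W W' : Type*} (sat : W → A → Prop) (sat' : W' → A' → Prop)
    (f : A → A') (g : W' → W)
    (h : ∀ (w' : W') (ψ : A), sat (g w') ψ ↔ sat' w' (f ψ)) :
    ∀ (S : Type*) (p : Set S → ℝ) (m' : S → W') (ρ : PSen A),
      ρ.sat sat p (g ∘ m') ↔ (ρ.map f).sat sat' p m' := by
  intro S p m' ρ
  have ht : ∀ t : PTerm A, t.interp sat p (g ∘ m') = (t.map f).interp sat' p m' := by
    intro t
    induction t with
    | const r => rfl
    | integral ψ => simp only [PTerm.interp, PTerm.map, Function.comp_apply, h]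
    | add t t' ih ih' => simp only [PTerm.interp, PTerm.map, ih, ih']
    | mul t t' ih ih' => simp only [PTerm.interp, PTerm.map, ih, ih']
  induction ρ with
  | lt t t' => simp only [PSen.sat, PSen.map, ht]
  | neg ρ ih => simp only [PSen.sat, PSen.map, ih]
  | conj ρ ρ' ih ih' => simp only [PSen.sat, PSen.map, ih, ih']
end

section
/- Let Nom, Nom', Λ, Λ' be sets of nominal and modality symbols, A, A' types of atomic sentences, W, W' types of base models, sat : W → A → Prop and sat' : W' → A' → Prop base satisfaction relations. Let φ₁ : Nom → Nom', φ₂ : Λ → Λ', f : A → A', and g : W' → W, where f and g satisfy the satisfaction condition: for all w' : W' and ψ : A, sat (g w') ψ ↔ sat' w' (f ψ). Then hybridisation preserves the satisfaction condition: for every hybrid model M' = (S, R'_•, R'_•, m') over (Nom', Λ') and W', every world w : S, and every hybrid formula ρ over (Nom, Λ, A), the reduct of M' along (φ₁, φ₂, g) satisfies ρ at world w (with respect to sat) if and only if M' satisfies map(φ₁, φ₂, f) ρ at world w (with respect to sat'). Consequently the same equivalence holds for global satisfaction. -/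
/-- Hybrid formulas over nominals `Nom`, modalities `Λ`, and atoms `A`. -/
inductive HForm (Nom Λ A : Type*) : Type _ where
  | nom : Nom → HForm Nom Λ A
  | atom : A → HForm Nom Λ A
  | neg : HForm Nom Λ A → HForm Nom Λ A
  | conj : HForm Nom Λ A → HForm Nom Λ A → HForm Nom Λ A
  | at_ : Nom → HForm Nom Λ A → HForm Nom Λ A
  | dia : Λ → HForm Nom Λ A → HForm Nom Λ A

/-- Translation of hybrid formulas along maps on nominals, modalities and atoms. -/
def HForm.map {Nom Nom' Λ Λ' A A' : Type*} (φ₁ : Nom → Nom') (φ₂ : Λ → Λ') (f : A → A') :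
    HForm Nom Λ A → HForm Nom' Λ' A'
  | .nom i => .nom (φ₁ i)
  | .atom ψ => .atom (f ψ)
  | .neg ρ => .neg (ρ.map φ₁ φ₂ f)
  | .conj ρ ρ' => .conj (ρ.map φ₁ φ₂ f) (ρ'.map φ₁ φ₂ f)
  | .at_ i ρ => .at_ (φ₁ i) (ρ.map φ₁ φ₂ f)
  | .dia l ρ => .dia (φ₂ l) (ρ.map φ₁ φ₂ f)

/-- A hybrid model over `(Nom, Λ)` and base models `W`, with worlds `S`. -/
structure HModel (Nom Λ W S : Type*) where
  Ri : Nom → S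
  Rl : Λ → Set (S × S)
  m : S → W

/-- The reduct of a hybrid model along `(φ₁, φ₂, g)`. -/
def HModel.reduct {Nom Nom' Λ Λ' W W' S : Type*} (φ₁ : Nom → Nom') (φ₂ : Λ → Λ')
    (g : W' → W) (M : HModel Nom' Λ' W' S) : HModel Nom Λ W S :=
  ⟨fun i => M.Ri (φ₁ i), fun l => M.Rl (φ₂ l), g ∘ M.m⟩

/-- Satisfaction of a hybrid formula at a world `w` of a hybrid model. -/
def HSat {Nom Λ A W S : Type*} (sat : W → A → Prop) (M : HModel Nom Λ W S) :
    S → HForm Nom Λ A → Prop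
  | w, .nom i => M.Ri i = w
  | w, .atom ψ => sat (M.m w) ψ
  | w, .neg ρ => ¬ HSat sat M w ρ
  | w, .conj ρ ρ' => HSat sat M w ρ ∧ HSat sat M w ρ'
  | _, .at_ i ρ => HSat sat M (M.Ri i) ρ
  | w, .dia l ρ => ∃ w', (w, w') ∈ M.Rl l ∧ HSat sat M w' ρ

theorem hybridisation_preserves_satisfaction_condition
    {Nom Nom' Λ Λ' A A' W W' S : Type*}
    (sat : W → A → Prop) (sat' : W' → A' → Prop)
    (φ₁ : Nom → Nom') (φ₂ : Λ → Λ') (f : A → A') (g : W' → W)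
    (h : ∀ (w' : W') (ψ : A), sat (g w') ψ ↔ sat' w' (f ψ)) :
    (∀ (M' : HModel Nom' Λ' W' S) (w : S) (ρ : HForm Nom Λ A),
      HSat sat (M'.reduct φ₁ φ₂ g) w ρ ↔ HSat sat' M' w (ρ.map φ₁ φ₂ f)) ∧
    (∀ (M' : HModel Nom' Λ' W' S) (ρ : HForm Nom Λ A),
      (∀ w : S, HSat sat (M'.reduct φ₁ φ₂ g) w ρ) ↔
      (∀ w : S, HSat sat' M' w (ρ.map φ₁ φ₂ f))) := by
  have key : ∀ (M' : HModel Nom' Λ' W' S) (ρ : HForm Nom Λ A) (w : S),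
      HSat sat (M'.reduct φ₁ φ₂ g) w ρ ↔ HSat sat' M' w (ρ.map φ₁ φ₂ f) := by
    intro M' ρ
    induction ρ with
    | nom i => intro w; exact Iff.rfl
    | atom ψ => intro w; exact h (M'.m w) ψ
    | neg ρ ih => intro w; exact not_congr (ih w)
    | conj ρ ρ' ih ih' => intro w; exact and_congr (ih w) (ih' w)
    | at_ i ρ ih => intro w; exact ih (M'.Ri (φ₁ i))
    | dia l ρ ih => intro w; exact exists_congr fun w' => and_congr Iff.rfl (ih w')
  exact ⟨fun M' w ρ => key M' ρ w, fun M' ρ => forall_congr' (key M' ρ)⟩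
end

section
/- The translation from temporalisation to hybridisation is satisfaction-preserving on the standard frame: fix a type A of atomic sentences, a type W of base models, sat : W → A → Prop, and m : ℕ → W. Let Nom = {init} (a one-element set) and Λ = {next, after, after*} (a three-element set), and let N_m be the hybrid model over (Nom, Λ) and W with carrier ℕ, R_init = 0, R_next = {(a, b) | b = a + 1}, R_after = {(a, b) | a < b}, R_after* = {(a, b) | a ≤ b}, and valuation m. Define the translation σ from until-free temporal formulas over A to hybrid formulas over (Nom, Λ, A) by: σ(ψ) = ψ for atoms ψ : A; σ(¬ρ) = ¬σ(ρ); σ(ρ ∧ ρ') = σ(ρ) ∧ σ(ρ'); σ(Xρ) = ¬⟨next⟩¬σ(ρ). Then for every until-free temporal formula ρ over A and every j : ℕ, the hybrid model N_m satisfies σ(ρ) at world j if and only if the temporal model m satisfies ρ at instant j. -/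
/-- Until-free temporal formulas over a type `A` of atomic sentences. -/
inductive TForm0 (A : Type*) : Type _ where
  | atom : A → TForm0 A
  | neg : TForm0 A → TForm0 A
  | conj : TForm0 A → TForm0 A → TForm0 A
  | next : TForm0 A → TForm0 A

/-- Satisfaction of an until-free temporal formula at instant `j`. -/
def TSat0 {A W : Type*} (sat : W → A → Prop) (m : ℕ → W) : ℕ → TForm0 A → Prop
  | j, .atom ψ => sat (m j) ψ
  | j, .neg ρ => ¬ TSat0 sat m j ρ
  | j, .conj ρ ρ' => TSat0 sat m j ρ ∧ TSat0 sat m j ρ'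
  | j, .next ρ => TSat0 sat m (j + 1) ρ

/-- The one-element set of nominal symbols. -/
inductive Nom1 : Type where
  | init

/-- The three-element set of modality symbols. -/
inductive Mod3 : Type where
  | next
  | after
  | afterStar

/-- The standard hybrid model on the frame of natural numbers, with valuation `m`. -/
def stdModel {W : Type*} (m : ℕ → W) : HModel Nom1 Mod3 W ℕ where
  Ri := fun _ => 0
  Rl := fun l =>
    match l with
    | .next => {p : ℕ × ℕ | p.2 = p.1 + 1}
    | .after => {p : ℕ × ℕ | p.1 < p.2}
    | .afterStar => {p : ℕ × ℕ | p.1 ≤ p.2}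
  m := m

/-- The translation from until-free temporal formulas to hybrid formulas. -/
def sigma {A : Type*} : TForm0 A → HForm Nom1 Mod3 A
  | .atom ψ => .atom ψ
  | .neg ρ => .neg (sigma ρ)
  | .conj ρ ρ' => .conj (sigma ρ) (sigma ρ')
  | .next ρ => .neg (.dia .next (.neg (sigma ρ)))

theorem sigma_satisfaction
    {A W : Type*} (sat : W → A → Prop) (m : ℕ → W) :
    ∀ (ρ : TForm0 A) (j : ℕ),
      HSat sat (stdModel m) j (sigma ρ) ↔ TSat0 sat m j ρ := by
  intro ρ
  induction ρ with
  | atom ψ => intro j; simp [sigma, HSat, TSat0, stdModel]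
  | neg ρ ih => intro j; simp [sigma, HSat, TSat0, ih]
  | conj ρ ρ' ih ih' => intro j; simp [sigma, HSat, TSat0, ih, ih']
  | next ρ ih =>
    intro j
    simp only [sigma, HSat, TSat0, ih]
    constructor
    · intro h
      by_contra hc
      exact h ⟨j + 1, rfl, hc⟩
    · rintro h ⟨w, hw, hn⟩
      have hw' : w = j + 1 := hw
      subst hw'
      exact hn h
end

section
/- The translation from temporalisation to hybridisation yields a comorphism on the standard frame: with A, W, sat, m, Nom = {init}, Λ = {next, after, after*}, the standard hybrid model N_m (carrier ℕ, R_init = 0, R_next = {(a, b) | b = a + 1}, R_after = {(a, b) | a < b}, R_after* = {(a, b) | a ≤ b}, valuation m), and the translation σ (σ(ψ) = ψ, σ(¬ρ) = ¬σ(ρ), σ(ρ ∧ ρ') = σ(ρ) ∧ σ(ρ'), σ(Xρ) = ¬⟨next⟩¬σ(ρ)) as given, for every until-free temporal formula ρ over A: N_m globally satisfies @_init σ(ρ) (i.e., at every world of ℕ) if and only if the temporal model m globally satisfies ρ (i.e., at instant 0). -/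
theorem sigma_sat_aux {A W : Type*} (sat : W → A → Prop) (m : ℕ → W) (ρ : TForm0 A) :
    ∀ j : ℕ, HSat sat (stdModel m) j (sigma ρ) ↔ TSat0 sat m j ρ := by
  induction ρ with
  | atom ψ => intro j; exact Iff.rfl
  | neg ρ ih => intro j; exact not_congr (ih j)
  | conj ρ ρ' ih ih' => intro j; exact and_congr (ih j) (ih' j)
  | next ρ ih =>
    intro j
    simp only [sigma, HSat, TSat0, stdModel, Set.mem_setOf_eq, exists_eq_left, not_not]
    exact ih (j + 1)

theorem sigma_comorphism
    {A W : Type*} (sat : W → A → Prop) (m : ℕ → W) :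
    ∀ ρ : TForm0 A,
      (∀ w : ℕ, HSat sat (stdModel m) w (.at_ .init (sigma ρ))) ↔
      TSat0 sat m 0 ρ := by
  intro ρ
  exact ⟨fun h => (sigma_sat_aux sat m ρ 0).1 (h 0),
    fun h _ => (sigma_sat_aux sat m ρ 0).2 h⟩
end
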